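/- arXiv:2103.04840 — 2 statements merged into one kernel-verified Lean document; each statement's English description precedes it below -/
import Mathlib

section
/- The map I ↦ I·V_A^ℬ is a bijection from the set of ideals of ℬ onto the set of ℬ[H]-submodules of V_A^ℬ. -/
set_option maxHeartbeats 1000000
set_option synthInstance.maxHeartbeats 1000000

noncomputable section

open scoped TensorProduct

/-! ## The base ring `𝒜`: the integral closure of `ℤ[1/p]` in a cyclotomic field -/

instance cycloAlgebra (p : ℕ) [NeZero p] (m : ℕ+) :
    Algebra (Localization.Away (p : ℤ)) (CyclotomicField m ℚ) :=
  (Localization.awayLift (algebraMap ℤ (CyclotomicField m ℚ)) _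
    (by
      rw [map_natCast]
      have h1 : IsUnit ((p : ℕ) : ℚ) :=
        isUnit_iff_ne_zero.mpr (Nat.cast_ne_zero.mpr (NeZero.ne p))
      have h2 := h1.map (algebraMap ℚ (CyclotomicField m ℚ))
      rwa [map_natCast] at h2)).toAlgebra

/-- The integral closure of `ℤ[1/p]` in the `m`-th cyclotomic field `ℚ(ζ_m)`. -/
def Aint (p : ℕ) [NeZero p] (m : ℕ+) :
    Subalgebra (Localization.Away (p : ℤ)) (CyclotomicField m ℚ) :=
  integralClosure (Localization.Away (p : ℤ)) (CyclotomicField m ℚ)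

/-- The ring `𝒜` associated to a finite field of characteristic `p` : the integral
closure of `ℤ[1/p]` in `ℚ(ζ_p)`. -/
def AA (p : ℕ+) : Type := ↥(Aint (p : ℕ) p)

instance (p : ℕ+) : CommRing (AA p) := inferInstanceAs (CommRing ↥(Aint (p : ℕ) p))

attribute [irreducible] AA

/-! ## The Heisenberg group -/

variable {F : Type*} [Field F] {W : Type*} [AddCommGroup W] [Module F W]

/-- The Heisenberg group attached to the bilinear form `β` : the set `W × F` with
multiplication `(w,t)(w',t') = (w+w', t+t'+½⟨w,w'⟩)`. -/
@[ext]
structure Heis (β : W →ₗ[F] W →ₗ[F] F) : Type _ where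
  w : W
  t : F

namespace Heis

variable {β : W →ₗ[F] W →ₗ[F] F}

instance : Mul (Heis β) :=
  ⟨fun a b => ⟨a.w + b.w, a.t + b.t + (2 : F)⁻¹ * β a.w b.w⟩⟩

instance : One (Heis β) := ⟨⟨0, 0⟩⟩

instance : Inv (Heis β) :=
  ⟨fun a => ⟨-a.w, -a.t + (2 : F)⁻¹ * β a.w a.w⟩⟩

@[simp] lemma mul_w (a b : Heis β) : (a * b).w = a.w + b.w := rfl
@[simp] lemma mul_t (a b : Heis β) :
    (a * b).t = a.t + b.t + (2 : F)⁻¹ * β a.w b.w := rfl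
@[simp] lemma one_w : (1 : Heis β).w = 0 := rfl
@[simp] lemma one_t : (1 : Heis β).t = 0 := rfl
@[simp] lemma inv_w (a : Heis β) : a⁻¹.w = -a.w := rfl
@[simp] lemma inv_t (a : Heis β) :
    a⁻¹.t = -a.t + (2 : F)⁻¹ * β a.w a.w := rfl

instance : Group (Heis β) where
  mul_assoc a b c := by
    ext
    · simp [add_assoc]
    · simp [map_add, LinearMap.add_apply]
      ring
  one_mul a := by ext <;> simp
  mul_one a := by ext <;> simp
  inv_mul_cancel a := by
    ext
    · simp
    · simp [map_neg, LinearMap.neg_apply]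

end Heis

/-! ## The induced representation `V_A^ℬ = ind_{A_H}^H(ψ_A^ℬ)` -/

/-- The compactly induced representation `ind_{A_H}^H ψ_A^ℬ`, realised as the
`ℬ`-submodule of functions `f : H → ℬ` with `f(ah) = ψ_A^ℬ(a) f(h)` for `a ∈ A_H`. -/
def IndV (β : W →ₗ[F] W →ₗ[F] F) (ℬ : Type*) [CommRing ℬ] (A : AddSubgroup W)
    (χ : Heis β → ℬˣ) : Submodule ℬ (Heis β → ℬ) where
  carrier := {f | ∀ a : Heis β, a.w ∈ A → ∀ h : Heis β, f (a * h) = (χ a : ℬ) * f h}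
  add_mem' := by
    intro f g hf hg a ha h
    simp only [Pi.add_apply, hf a ha h, hg a ha h, mul_add]
  zero_mem' := by intro a ha h; simp
  smul_mem' := by
    intro c f hf a ha h
    simp only [Pi.smul_apply, smul_eq_mul, hf a ha h]
    ring

/-- Right translation action of `h₀ ∈ H` on functions `H → ℬ`. -/
def hAct (β : W →ₗ[F] W →ₗ[F] F) (ℬ : Type*) [CommRing ℬ] (h₀ : Heis β) :
    (Heis β → ℬ) →ₗ[ℬ] (Heis β → ℬ) where
  toFun f := fun h => f (h * h₀)
  map_add' _ _ := rfl
  map_smul' _ _ := rfl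

lemma hAct_mem (β : W →ₗ[F] W →ₗ[F] F) (ℬ : Type*) [CommRing ℬ] (A : AddSubgroup W)
    (χ : Heis β → ℬˣ) (h₀ : Heis β) (f : Heis β → ℬ) (hf : f ∈ IndV β ℬ A χ) :
    hAct β ℬ h₀ f ∈ IndV β ℬ A χ := by
  intro a ha h
  simpa [hAct, mul_assoc] using hf a ha (h * h₀)

/-- The action `ρ` of the Heisenberg group on `V_A^ℬ`. -/
def hActV (β : W →ₗ[F] W →ₗ[F] F) (ℬ : Type*) [CommRing ℬ] (A : AddSubgroup W)
    (χ : Heis β → ℬˣ) (h₀ : Heis β) :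
    ↥(IndV β ℬ A χ) →ₗ[ℬ] ↥(IndV β ℬ A χ) :=
  (hAct β ℬ h₀).restrict fun f hf => hAct_mem β ℬ A χ h₀ f hf

/-! ## The symplectic group and its action on the Heisenberg group -/

/-- Action of a linear automorphism `g` on the Heisenberg group: `g·(w,t) = (gw,t)`. -/
def gHeis (β : W →ₗ[F] W →ₗ[F] F) (g : W ≃ₗ[F] W) : Heis β → Heis β :=
  fun h => ⟨g h.w, h.t⟩

/-- The symplectic group `Sp(W)` of the form `β`, as a subgroup of the linear
automorphism group of `W`. -/
def SpGrp (β : W →ₗ[F] W →ₗ[F] F) : Subgroup (W ≃ₗ[F] W) where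
  carrier := {g | ∀ u v : W, β (g u) (g v) = β u v}
  one_mem' := fun _ _ => rfl
  mul_mem' := by
    intro g g' hg hg' u v
    have h : ∀ x, (g * g') x = g (g' x) := fun _ => rfl
    rw [h, h, hg, hg']
  inv_mem' := by
    intro g hg u v
    have h1 := hg (g⁻¹ u) (g⁻¹ v)
    have h2 : ∀ x, g (g⁻¹ x) = x := fun x => g.apply_symm_apply x
    rw [h2, h2] at h1
    exact h1.symm

/-- The defining condition of the metaplectic group over `ℬ` : pairs `(g, M)` with
`g ∈ Sp(W)` and `M ∘ ρ(h) = ρ(g·h) ∘ M` for all `h ∈ H`. -/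
def MetaCond (β : W →ₗ[F] W →ₗ[F] F) (ℬ : Type*) [CommRing ℬ] (A : AddSubgroup W)
    (χ : Heis β → ℬˣ)
    (x : (W ≃ₗ[F] W) × (↥(IndV β ℬ A χ) ≃ₗ[ℬ] ↥(IndV β ℬ A χ))) : Prop :=
  (∀ u v : W, β (x.1 u) (x.1 v) = β u v) ∧
    ∀ (h₀ : Heis β) (f : ↥(IndV β ℬ A χ)),
      x.2 (hActV β ℬ A χ h₀ f) = hActV β ℬ A χ (gHeis β x.1 h₀) (x.2 f)

/-- The character `ψ_A^ℬ = φ ∘ ψ_A` of `A_H` with values in `ℬˣ`, obtained from a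
character with values in `𝒜ˣ` via the structure morphism `φ : 𝒜 → ℬ`. -/
def chB (p : ℕ+) (ℬ : Type*) [CommRing ℬ] [Algebra (AA p) ℬ]
    {β : W →ₗ[F] W →ₗ[F] F} (ψA : Heis β → (AA p)ˣ) : Heis β → ℬˣ :=
  fun h => Units.map (algebraMap (AA p) ℬ).toMonoidHom (ψA h)

/-- The character `ψ^ℬ = φ ∘ ψ` of `F` with values in `ℬˣ`. -/
def psB (p : ℕ+) (ℬ : Type*) [CommRing ℬ] [Algebra (AA p) ℬ]
    (ψ : F → (AA p)ˣ) : F → ℬˣ :=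
  fun t => Units.map (algebraMap (AA p) ℬ).toMonoidHom (ψ t)

section AbstractInduced

open scoped Classical in
/-- The function supported on the coset `A_H h₀` sending `a h₀` to `χ a`. -/
def cosetDelta (β : W →ₗ[F] W →ₗ[F] F) (ℬ : Type*) [CommRing ℬ] (A : AddSubgroup W)
    (χ : Heis β → ℬˣ) (h₀ : Heis β) : Heis β → ℬ :=
  fun h => if h.w - h₀.w ∈ A then (χ (h * h₀⁻¹) : ℬ) else 0

variable {β : W →ₗ[F] W →ₗ[F] F} {ℬ : Type*} [CommRing ℬ] {A : AddSubgroup W}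
  {χ : Heis β → ℬˣ}

lemma hAct_cosetDelta (h₀ k : Heis β) :
    hAct β ℬ k (cosetDelta β ℬ A χ h₀) = cosetDelta β ℬ A χ (h₀ * k⁻¹) := by
  funext h
  have hw : (h * k).w - h₀.w = h.w - (h₀ * k⁻¹).w := by
    simp only [Heis.mul_w, Heis.inv_w]
    abel
  simp only [hAct, cosetDelta, LinearMap.coe_mk, AddHom.coe_mk, mul_inv_rev, inv_inv,
    mul_assoc]
  congr 2

lemma cosetDelta_mem
    (hχ : ∀ a b : Heis β, a.w ∈ A → b.w ∈ A → χ (a * b) = χ a * χ b) (h₀ : Heis β) :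
    cosetDelta β ℬ A χ h₀ ∈ IndV β ℬ A χ := by
  intro a ha h
  have hiff : (a * h).w - h₀.w ∈ A ↔ h.w - h₀.w ∈ A := by
    rw [Heis.mul_w, add_sub_assoc]
    exact A.add_mem_cancel_left ha
  by_cases hh : h.w - h₀.w ∈ A
  · simp only [cosetDelta, if_pos hh, if_pos (hiff.mpr hh)]
    rw [mul_assoc, hχ _ _ ha (by simpa [sub_eq_add_neg] using hh), Units.val_mul]
  · simp only [cosetDelta, if_neg hh, if_neg (mt hiff.mp hh), mul_zero]

/-- Restricting an element of the induced module to the coset of `h₀` gives the multiple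
`f h₀` of the delta function there. -/
lemma smul_cosetDelta_apply {f : Heis β → ℬ} (hf : f ∈ IndV β ℬ A χ) (h₀ h : Heis β) :
    (f h₀ • cosetDelta β ℬ A χ h₀) h = open scoped Classical in
      if h.w - h₀.w ∈ A then f h else 0 := by
  simp only [cosetDelta, Pi.smul_apply, smul_eq_mul, mul_ite, mul_zero]
  split_ifs with hh
  · have := hf (h * h₀⁻¹) (by simpa [sub_eq_add_neg] using hh) h₀
    rw [inv_mul_cancel_right] at this
    rw [this, mul_comm]
  · rfl

lemma card_smul_eq_sum_cosetDelta [Fintype W] [Fintype A] {f : Heis β → ℬ}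
    (hf : f ∈ IndV β ℬ A χ) :
    (Fintype.card A : ℬ) • f = ∑ w : W, f ⟨w, 0⟩ • cosetDelta β ℬ A χ ⟨w, 0⟩ := by
  classical
  funext h
  rw [Finset.sum_apply]
  simp only [smul_cosetDelta_apply hf]
  rw [← Equiv.sum_comp (Equiv.subLeft h.w)]
  simp only [Equiv.subLeft_apply, sub_sub_cancel]
  rw [← Finset.sum_filter, Finset.sum_const, Pi.smul_apply, smul_eq_mul, nsmul_eq_mul,
    Fintype.card_subtype]

/-- Conjugating `(a, 0)` by `h` shifts the central coordinate by `⟨h, a⟩`. -/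
lemma apply_mul_of_mem_IndV (h2 : (2 : F) ≠ 0) (halt : ∀ v : W, β v v = 0)
    (hχ : ∀ a b : Heis β, a.w ∈ A → b.w ∈ A → χ (a * b) = χ a * χ b)
    {f : Heis β → ℬ} (hf : f ∈ IndV β ℬ A χ) (h : Heis β) {a : W} (ha : a ∈ A) :
    f (h * ⟨a, 0⟩) = (χ ⟨a, 0⟩ * χ ⟨0, β h.w a⟩ : ℬˣ) * f h := by
  have hskew : β a h.w = - β h.w a := by
    have := halt (a + h.w)
    simp only [map_add, LinearMap.add_apply, halt, zero_add, add_zero] at this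
    linear_combination this
  have hconj : h * ⟨a, 0⟩ = (⟨a, 0⟩ * ⟨0, β h.w a⟩ : Heis β) * h := by
    ext
    · simp [add_comm]
    · simp only [Heis.mul_t, Heis.mul_w, map_zero, add_zero, hskew]
      field_simp
      ring
  rw [hconj, hf _ (by simpa using ha), hχ _ _ ha A.zero_mem]

/-- An invariant submodule contains the restriction of each of its elements to each coset. -/
lemma smul_cosetDelta_mem (h2 : (2 : F) ≠ 0) (halt : ∀ v : W, β v v = 0)
    (hχ : ∀ a b : Heis β, a.w ∈ A → b.w ∈ A → χ (a * b) = χ a * χ b)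
    [Fintype A] (hcard : IsUnit (Fintype.card A : ℬ))
    (horth : ∀ v : W, ∑ a : A, (χ ⟨0, β v a⟩ : ℬ) = open scoped Classical in
      if v ∈ A then (Fintype.card A : ℬ) else 0)
    {N : Submodule ℬ (Heis β → ℬ)} (hN : N ≤ IndV β ℬ A χ)
    (hinv : ∀ (h₀ : Heis β) (f : Heis β → ℬ), f ∈ N → hAct β ℬ h₀ f ∈ N)
    {f : Heis β → ℬ} (hf : f ∈ N) (h₀ : Heis β) :
    f h₀ • cosetDelta β ℬ A χ h₀ ∈ N := by
  classical
  have key : (Fintype.card A : ℬ) • (f h₀ • cosetDelta β ℬ A χ h₀) =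
      ∑ a : A, (((χ ⟨a, 0⟩)⁻¹ * χ ⟨0, -β h₀.w a⟩ : ℬˣ) : ℬ) • hAct β ℬ ⟨a, 0⟩ f := by
    funext h
    rw [Pi.smul_apply, smul_cosetDelta_apply (hN hf), Finset.sum_apply]
    have hterm : ∀ a : A, ((((χ ⟨a, 0⟩)⁻¹ * χ ⟨0, -β h₀.w a⟩ : ℬˣ) : ℬ) •
        hAct β ℬ ⟨a, 0⟩ f) h = (χ ⟨0, β (h.w - h₀.w) a⟩ : ℬ) * f h := by
      intro a
      have hprod : χ ⟨0, β (h.w - h₀.w) a⟩ = χ ⟨0, -β h₀.w a⟩ * χ ⟨0, β h.w a⟩ := by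
        rw [← hχ _ _ A.zero_mem A.zero_mem]
        congr 1
        ext
        · simp
        · simp [sub_eq_neg_add]
      change (((χ ⟨a, 0⟩)⁻¹ * χ ⟨0, -β h₀.w a⟩ : ℬˣ) : ℬ) * f (h * ⟨a, 0⟩) = _
      rw [apply_mul_of_mem_IndV h2 halt hχ (hN hf) h a.2, hprod, ← mul_assoc, ← Units.val_mul]
      congr 2
      rw [mul_mul_mul_comm, inv_mul_cancel, one_mul]
    rw [Finset.sum_congr rfl fun a _ => hterm a, ← Finset.sum_mul, horth]
    split_ifs <;> simp
  rw [← Submodule.smul_mem_iff_of_isUnit N hcard, key]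
  exact N.sum_mem fun a _ => N.smul_mem _ (hinv _ _ hf)

/-- The correspondence between ideals and invariant submodules, for a character of `A_H`
whose restriction to the centre satisfies the orthogonality relations on `A`. -/
lemma bijOn_ideal_smul_IndV (h2 : (2 : F) ≠ 0) (halt : ∀ v : W, β v v = 0)
    (hχ : ∀ a b : Heis β, a.w ∈ A → b.w ∈ A → χ (a * b) = χ a * χ b)
    [Fintype W] [Fintype A] (hcard : IsUnit (Fintype.card A : ℬ))
    (horth : ∀ v : W, ∑ a : A, (χ ⟨0, β v a⟩ : ℬ) = open scoped Classical in
      if v ∈ A then (Fintype.card A : ℬ) else 0) :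
    Set.BijOn (fun I : Ideal ℬ => I • IndV β ℬ A χ) Set.univ
      {N : Submodule ℬ (Heis β → ℬ) |
        N ≤ IndV β ℬ A χ ∧
        ∀ (h₀ : Heis β) (f : Heis β → ℬ), f ∈ N → hAct β ℬ h₀ f ∈ N} := by
  have hχ1 : χ 1 = 1 := by
    have := hχ 1 1 A.zero_mem A.zero_mem
    rwa [mul_one, left_eq_mul] at this
  refine ⟨fun I _ => ⟨Submodule.smul_le_right, fun h₀ f hf => ?_⟩, ?_, ?_⟩
  · have hle : I • IndV β ℬ A χ ≤ (I • IndV β ℬ A χ).comap (hAct β ℬ h₀) :=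
      Submodule.smul_le.mpr fun r hr n hn => by
        rw [Submodule.mem_comap, map_smul]
        exact Submodule.smul_mem_smul hr (hAct_mem β ℬ A χ h₀ n hn)
    exact hle hf
  · have hmem : ∀ (I : Ideal ℬ) (b : ℬ),
        b ∈ I ↔ b • cosetDelta β ℬ A χ 1 ∈ I • IndV β ℬ A χ := by
      refine fun I b => ⟨fun hb => Submodule.smul_mem_smul hb (cosetDelta_mem hχ 1),
        fun hb => ?_⟩
      have hle : I • IndV β ℬ A χ ≤ Submodule.comap (LinearMap.proj 1) I :=
        Submodule.smul_le.mpr fun r hr n _ => by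
          simpa using I.mul_mem_right _ hr
      simpa [cosetDelta, hχ1] using hle hb
    intro I _ J _ hIJ
    ext b
    rw [hmem I, hmem J, show I • IndV β ℬ A χ = J • IndV β ℬ A χ from hIJ]
  · rintro N ⟨hN, hinv⟩
    have htrans : ∀ (b : ℬ) (h k : Heis β), b • cosetDelta β ℬ A χ h ∈ N →
        b • cosetDelta β ℬ A χ k ∈ N := by
      intro b h k hb
      have := hinv (k⁻¹ * h) _ hb
      rwa [map_smul, hAct_cosetDelta, mul_inv_rev, inv_inv, mul_inv_cancel_left] at this
    refine ⟨N.comap (LinearMap.toSpanSingleton ℬ _ (cosetDelta β ℬ A χ 1)), trivial,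
      le_antisymm (Submodule.smul_le.mpr fun b hb g hg => ?_) fun f hf => ?_⟩
    · rw [← Submodule.smul_mem_iff_of_isUnit N hcard, smul_comm,
        card_smul_eq_sum_cosetDelta hg, Finset.smul_sum]
      refine N.sum_mem fun w _ => ?_
      rw [smul_comm]
      exact N.smul_mem _ (htrans b 1 _ hb)
    · rw [← Submodule.smul_mem_iff_of_isUnit _ hcard, card_smul_eq_sum_cosetDelta (hN hf)]
      refine Submodule.sum_mem _ fun w _ => Submodule.smul_mem_smul ?_ (cosetDelta_mem hχ _)
      exact htrans _ _ _ (smul_cosetDelta_mem h2 halt hχ hcard horth hN hinv hf _)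

end AbstractInduced

section BaseRing

instance isDomain_AA (p : ℕ+) : IsDomain (AA p) := by
  have h : IsDomain ↥(Aint (p : ℕ) p) := inferInstance
  with_unfolding_all exact h

lemma isUnit_natCast_AA (p : ℕ+) : IsUnit (((p : ℕ) : ℕ) : AA p) := by
  have h : IsUnit (((p : ℕ) : ℕ) : ↥(Aint (p : ℕ) p)) := by
    have h1 := (IsLocalization.Away.algebraMap_isUnit (S := Localization.Away ((p : ℕ) : ℤ))
      ((p : ℕ) : ℤ)).map (algebraMap _ ↥(Aint (p : ℕ) p))
    simpa using h1
  with_unfolding_all exact h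

end BaseRing

/-- Orthogonality: a nontrivial character of a finite group sums to zero in a domain. -/
lemma sum_units_eq_zero_of_ne_one {G R : Type*} [AddCommGroup G] [Fintype G] [CommRing R]
    [IsDomain R] (θ : G → Rˣ) (hθ : ∀ x y, θ (x + y) = θ x * θ y) {g : G} (hg : θ g ≠ 1) :
    ∑ x, (θ x : R) = 0 := by
  have h : (θ g : R) * ∑ x, (θ x : R) = ∑ x, (θ x : R) := by
    rw [Finset.mul_sum, ← Equiv.sum_comp (Equiv.addLeft g) fun x => (θ x : R)]
    simp [hθ]
  exact eq_zero_of_mul_eq_self_left (fun h1 => hg (Units.ext h1)) h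

/-- The map `I ↦ I·V_A^ℬ` is a bijection from the set of ideals of `ℬ`
onto the set of `ℬ[H]`-submodules of `V_A^ℬ`. -/
theorem statement_1
    (p : ℕ+) [Fact (Nat.Prime (p : ℕ))] (hp2 : (p : ℕ) ≠ 2)
    {F : Type*} [Field F] [Fintype F] [CharP F (p : ℕ)]
    {W : Type*} [AddCommGroup W] [Module F W] [FiniteDimensional F W]
    (β : W →ₗ[F] W →ₗ[F] F)
    (halt : ∀ v : W, β v v = 0)
    (hnd : ∀ v : W, (∀ u : W, β v u = 0) → v = 0)
    (ℬ : Type*) [CommRing ℬ] [Algebra (AA p) ℬ]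
    (ψ : F → (AA p)ˣ) (hψ : ∀ x y : F, ψ (x + y) = ψ x * ψ y)
    (hψnt : ∃ x : F, ψ x ≠ 1)
    (A : AddSubgroup W)
    (hA : ∀ v : W, (∀ a ∈ A, ψ (β v a) = 1) ↔ v ∈ A)
    (ψA : Heis β → (AA p)ˣ)
    (hψA : ∀ a b : Heis β, a.w ∈ A → b.w ∈ A → ψA (a * b) = ψA a * ψA b)
    (hψAext : ∀ t : F, ψA ⟨0, t⟩ = ψ t) :
    Set.BijOn (fun I : Ideal ℬ => I • IndV β ℬ A (chB p ℬ ψA)) Set.univ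
      {N : Submodule ℬ (Heis β → ℬ) |
        N ≤ IndV β ℬ A (chB p ℬ ψA) ∧
        ∀ (h₀ : Heis β) (f : Heis β → ℬ), f ∈ N → hAct β ℬ h₀ f ∈ N} := by
  classical
  have h2 : (2 : F) ≠ 0 := Ring.two_ne_zero (by rwa [ringChar.eq F (p : ℕ)])
  have : Finite W := Module.finite_of_finite F
  have := Fintype.ofFinite W
  have := Fintype.ofFinite A
  have hchar : ∀ v : W, (p : ℕ) • v = 0 := fun v => by
    rw [← Nat.cast_smul_eq_nsmul F, CharP.cast_eq_zero, zero_smul]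
  have hcard : IsUnit (Fintype.card A : AA p) := by
    have hpg : IsPGroup (p : ℕ) (Multiplicative A) := fun a =>
      ⟨1, by
        rw [pow_one]
        exact Subtype.ext (hchar (a.toAdd : W))⟩
    obtain ⟨n, hn⟩ := IsPGroup.iff_card.mp hpg
    have hn' : Fintype.card A = (p : ℕ) ^ n := by
      rw [← hn, ← Nat.card_eq_fintype_card]
      rfl
    rw [hn', Nat.cast_pow]
    exact (isUnit_natCast_AA p).pow n
  have horth : ∀ v : W, ∑ a : A, (ψ (β v a) : AA p) =
      if v ∈ A then (Fintype.card A : AA p) else 0 := by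
    intro v
    split_ifs with hv
    · simp [fun a : A => (hA v).mpr hv a a.2]
    · rw [← hA v] at hv
      push Not at hv
      obtain ⟨a, ha, hne⟩ := hv
      exact sum_units_eq_zero_of_ne_one (fun a : A => ψ (β v a))
        (fun x y => by simp [hψ]) (g := ⟨a, ha⟩) hne
  refine bijOn_ideal_smul_IndV h2 halt (fun a b ha hb => ?_) ?_ fun v => ?_
  · simp only [chB, hψA a b ha hb, map_mul]
  · simpa using hcard.map (algebraMap (AA p) ℬ)
  · have := congrArg (algebraMap (AA p) ℬ) (horth v)
    rw [map_sum, apply_ite (algebraMap (AA p) ℬ), map_natCast, map_zero] at this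
    simpa [chB, hψAext] using this
end
end

section
/- The set S̃p_A^ℬ(W) = {(g,M) ∈ Sp(W) × GL_ℬ(V_A^ℬ) : M ∘ ρ(h) = ρ(g·h) ∘ M for all h ∈ H} is a subgroup of the product group Sp(W) × GL_ℬ(V_A^ℬ); the first projection p_ℬ : S̃p_A^ℬ(W) → Sp(W) is a surjective group homomorphism, and its kernel equals {(id_W, λ·id) : λ ∈ ℬ^×}, which is central in S̃p_A^ℬ(W) and isomorphic to ℬ^×. Thus S̃p_A^ℬ(W) is a central extension of Sp(W) by ℬ^× (the metaplectic group over ℬ). -/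
set_option maxHeartbeats 1000000
set_option synthInstance.maxHeartbeats 1000000

noncomputable section

open scoped TensorProduct

/-! ## The Heisenberg group -/

variable {F : Type*} [Field F] {W : Type*} [AddCommGroup W] [Module F W]

/-! ## Properties of the base ring `𝒜` -/

lemma AA_isDomain (p : ℕ+) : IsDomain (AA p) := by
  with_unfolding_all exact inferInstanceAs (IsDomain ↥(Aint (p : ℕ) p))

lemma AA_charZero (p : ℕ+) : CharZero (AA p) := by
  have h : CharZero ↥(Aint (p : ℕ) p) :=
    (algebraMap ↥(Aint (p : ℕ) p) (CyclotomicField p ℚ)).charZero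
  with_unfolding_all exact h

lemma AA_isUnit_natCast (p : ℕ+) : IsUnit ((p : ℕ) : AA p) := by
  have h : IsUnit (((p : ℕ) : ↥(Aint (p : ℕ) p))) := by
    have h1 := (IsLocalization.Away.algebraMap_isUnit
      (S := Localization.Away ((p : ℕ) : ℤ)) ((p : ℕ) : ℤ)).map
        (algebraMap (Localization.Away ((p : ℕ) : ℤ)) ↥(Aint (p : ℕ) p))
    simpa using h1
  with_unfolding_all exact h

/-! ## Sums of characters -/

lemma sum_eq_zero_of_translate {G R : Type*} [Fintype G] [CommRing R] [IsDomain R]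
    (f : G → R) (e : G ≃ G) {c : R} (hc : c ≠ 1) (h : ∀ x, f (e x) = c * f x) :
    ∑ x, f x = 0 := by
  have h1 : c * ∑ x, f x = ∑ x, f x := by
    rw [Finset.mul_sum, ← Finset.sum_congr rfl fun x _ => h x]
    exact Equiv.sum_comp e f
  have h2 : (c - 1) * ∑ x, f x = 0 := by rw [sub_mul, h1, one_mul, sub_self]
  exact (mul_eq_zero.mp h2).resolve_left (sub_ne_zero.mpr hc)

open Classical in
lemma isUnit_sum_indicator_subgroup {G R : Type*} [Group G] [Fintype G] [CommRing R]
    (hG : IsUnit (Fintype.card G : R)) (K : Subgroup G) :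
    IsUnit (∑ b : G, if b ∈ K then (1 : R) else 0) := by
  rw [Finset.sum_boole, ← Fintype.card_subtype]
  refine isUnit_of_dvd_unit (Nat.cast_dvd_cast ?_) hG
  have := K.card_subgroup_dvd_card
  rwa [Nat.card_eq_fintype_card, Nat.card_eq_fintype_card] at this

/-! ## The subgroups `A_H` of the Heisenberg group -/

namespace Heis

variable {β : W →ₗ[F] W →ₗ[F] F}

/-- The Heisenberg group as a set is `W × F`. -/
def equivProd (β : W →ₗ[F] W →ₗ[F] F) : Heis β ≃ W × F where
  toFun h := (h.w, h.t)
  invFun x := ⟨x.1, x.2⟩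

instance [Finite F] [Finite W] : Finite (Heis β) := Finite.of_equiv _ (equivProd β).symm

/-- The subgroup `A_H = A × F` of the Heisenberg group. -/
def polar (β : W →ₗ[F] W →ₗ[F] F) (A : AddSubgroup W) : Subgroup (Heis β) where
  carrier := {a | a.w ∈ A}
  one_mem' := A.zero_mem
  mul_mem' := fun ha hb => A.add_mem ha hb
  inv_mem' := fun ha => A.neg_mem ha

instance [Finite F] [Finite W] (K : Subgroup (Heis β)) : Fintype K := Fintype.ofFinite _

lemma mem_polar {A : AddSubgroup W} {a : Heis β} : a ∈ polar β A ↔ a.w ∈ A := Iff.rfl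

lemma swap_of_alternating (halt : ∀ v : W, β v v = 0) (u v : W) : β u v = -β v u := by
  have h := halt (u + v)
  simp only [map_add, LinearMap.add_apply, halt, zero_add, add_zero] at h
  linear_combination h

lemma mul_eq_central_mul (h2 : (2 : F) ≠ 0) (halt : ∀ v : W, β v v = 0) (h a : Heis β) :
    h * a = ⟨0, β h.w a.w⟩ * (a * h) := by
  ext
  · simp [add_comm]
  · simp only [mul_t, mul_w, map_zero, LinearMap.zero_apply, mul_zero]
    rw [swap_of_alternating halt a.w h.w]
    field_simp
    ring

lemma conj_eq_central_mul (h2 : (2 : F) ≠ 0) (halt : ∀ v : W, β v v = 0) (h a : Heis β) :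
    h * a * h⁻¹ = ⟨0, β h.w a.w⟩ * a := by
  rw [mul_eq_central_mul h2 halt h a, mul_assoc, mul_inv_cancel_right]

end Heis

open Heis

/-! ## Polarizations and their induced representations -/

/-- A character `χ` of `A_H` extending the central character `θ`, for which the finite Fourier
analysis on `A_H` works over `ℬ`. -/
structure IsPolarization [Finite F] [Finite W] {β : W →ₗ[F] W →ₗ[F] F} {ℬ : Type*} [CommRing ℬ]
    (θ : F → ℬˣ) (A : AddSubgroup W) (χ : Heis β → ℬˣ) : Prop where
  mul : ∀ a b : Heis β, a.w ∈ A → b.w ∈ A → χ (a * b) = χ a * χ b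
  central : ∀ t : F, χ ⟨0, t⟩ = θ t
  map_zero : θ 0 = 1
  isotropic : ∀ v ∈ A, ∀ a ∈ A, θ (β v a) = 1
  sum_eq_zero : ∀ v ∉ A, ∑ a : polar β A, (θ (β v a.1.w) : ℬ) = 0
  card_isUnit : IsUnit (Fintype.card (polar β A) : ℬ)

namespace IsPolarization

variable [Finite F] [Finite W] {β : W →ₗ[F] W →ₗ[F] F} {ℬ : Type*} [CommRing ℬ]
  {θ : F → ℬˣ} {A B : AddSubgroup W} {χ χ' : Heis β → ℬˣ}

lemma map_one (hχ : IsPolarization θ A χ) : χ 1 = 1 :=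
  (hχ.central 0).trans hχ.map_zero

open Classical in
lemma sum_pairing (hχ : IsPolarization θ A χ) (v : W) :
    ∑ a : polar β A, (θ (β v a.1.w) : ℬ) =
      if v ∈ A then (Fintype.card (polar β A) : ℬ) else 0 := by
  split_ifs with hv
  · rw [Finset.sum_congr rfl fun a _ => by rw [hχ.isotropic v hv _ a.2]]
    simp
  · exact hχ.sum_eq_zero v hv

lemma apply_mul_mul (h2 : (2 : F) ≠ 0) (halt : ∀ v : W, β v v = 0) (hχ : IsPolarization θ A χ)
    {f : Heis β → ℬ} (hf : f ∈ IndV β ℬ A χ) (h x : Heis β) {a : Heis β} (ha : a.w ∈ A) :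
    f (h * a * x) = θ (β h.w a.w) * (χ a * f (h * x)) := by
  rw [mul_eq_central_mul h2 halt h a, mul_assoc, hf _ A.zero_mem, mul_assoc, hf a ha, hχ.central]

open Classical in
lemma sum_apply_mul_mul (h2 : (2 : F) ≠ 0) (halt : ∀ v : W, β v v = 0)
    (hχ : IsPolarization θ A χ)
    {f : Heis β → ℬ} (hf : f ∈ IndV β ℬ A χ) (h x : Heis β) :
    ∑ a : polar β A, (((χ a)⁻¹ : ℬˣ) : ℬ) * f (h * a * x) =
      if h.w ∈ A then (Fintype.card (polar β A) : ℬ) * f (h * x) else 0 := by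
  calc _ = ∑ a : polar β A, (θ (β h.w a.1.w) : ℬ) * f (h * x) :=
        Finset.sum_congr rfl fun a _ => by
          rw [hχ.apply_mul_mul h2 halt hf h x a.2, mul_left_comm, Units.inv_mul_cancel_left]
    _ = _ := by rw [← Finset.sum_mul, hχ.sum_pairing, ite_mul, zero_mul]

open Classical in
/-- The function supported on `A_H` that equals `χ` there. -/
def delta (hχ : IsPolarization θ A χ) : ↥(IndV β ℬ A χ) :=
  ⟨fun h => if h.w ∈ A then (χ h : ℬ) else 0, fun a ha h => by
    simp only [mul_w, A.add_mem_cancel_left ha]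
    split_ifs with hh
    · rw [hχ.mul a h ha hh, Units.val_mul]
    · rw [mul_zero]⟩

lemma delta_one (hχ : IsPolarization θ A χ) : hχ.delta.1 1 = 1 := by
  simp [delta, A.zero_mem, hχ.map_one]

/-- Endomorphisms of `V_A` commuting with the Heisenberg group are scalars. -/
lemma eq_smul_of_commute (h2 : (2 : F) ≠ 0) (halt : ∀ v : W, β v v = 0)
    (hχ : IsPolarization θ A χ) (M : ↥(IndV β ℬ A χ) →ₗ[ℬ] ↥(IndV β ℬ A χ))
    (hM : ∀ h f, M (hActV β ℬ A χ h f) = hActV β ℬ A χ h (M f)) (f : ↥(IndV β ℬ A χ)) :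
    M f = (M hχ.delta).1 1 • f := by
  classical
  let e (f : ↥(IndV β ℬ A χ)) : ↥(IndV β ℬ A χ) :=
    ∑ a : polar β A, (((χ a)⁻¹ : ℬˣ) : ℬ) • hActV β ℬ A χ a f
  have he (f : ↥(IndV β ℬ A χ)) :
      e f = ((Fintype.card (polar β A) : ℬ) * f.1 1) • hχ.delta := by
    ext h
    have h1 := hχ.sum_apply_mul_mul h2 halt f.2 h 1
    simp only [mul_one] at h1
    have h3 : (e f).1 h = ∑ a : polar β A, (((χ a)⁻¹ : ℬˣ) : ℬ) * f.1 (h * a) := by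
      simp only [e, AddSubmonoidClass.coe_finsetSum, Finset.sum_apply]
      rfl
    rw [h3, h1]
    change _ = _ * (if h.w ∈ A then (χ h : ℬ) else 0)
    split_ifs with hh
    · have := f.2 h hh 1
      rw [mul_one] at this
      rw [this]; ring
    · rw [mul_zero]
  have hcomm (f : ↥(IndV β ℬ A χ)) : e (M f) = M (e f) := by
    simp only [e, map_sum, map_smul, hM]
  have hone (f : ↥(IndV β ℬ A χ)) : (M f).1 1 = (M hχ.delta).1 1 * f.1 1 := by
    have h1 := congrArg (fun x => x.1 1) (hcomm f)
    simp only [he, map_smul, SetLike.val_smul, Pi.smul_apply, smul_eq_mul, delta_one] at h1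
    refine hχ.card_isUnit.mul_left_cancel ?_
    linear_combination h1
  ext h
  have h1 := hone (hActV β ℬ A χ h f)
  rw [hM] at h1
  have h3 (f : ↥(IndV β ℬ A χ)) : (hActV β ℬ A χ h f).1 1 = f.1 h :=
    congrArg f.1 (one_mul h)
  rwa [h3, h3] at h1

/-- The averaging map `f ↦ (h ↦ ∑_{b ∈ B_H} χ'(b)⁻¹ f(ω b h))` from `V_A` to `V_B`. -/
def average (hχ' : IsPolarization θ B χ') (A : AddSubgroup W) (χ : Heis β → ℬˣ) (ω : Heis β) :
    ↥(IndV β ℬ A χ) →ₗ[ℬ] ↥(IndV β ℬ B χ') where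
  toFun f := ⟨fun h => ∑ b : polar β B, (((χ' b)⁻¹ : ℬˣ) : ℬ) * f.1 (ω * b * h), by
    intro c hc h
    rw [Finset.mul_sum]
    refine Eq.trans (Finset.sum_congr rfl fun b _ => ?_)
      (Equiv.sum_comp (Equiv.mulRight (⟨c, hc⟩ : polar β B)) _)
    have h1 : χ' (b.1 * c) = χ' b.1 * χ' c := hχ'.mul _ _ b.2 hc
    simp only [Equiv.coe_mulRight, Subgroup.coe_mul, h1, mul_inv_rev, Units.val_mul,
      Units.mul_inv_cancel_left, mul_assoc]⟩
  map_add' f g := by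
    ext h
    simp [mul_add, Finset.sum_add_distrib]
  map_smul' c f := by
    ext h
    simp [Finset.mul_sum, mul_left_comm]

lemma average_hActV (hχ' : IsPolarization θ B χ') (ω h : Heis β) (f : ↥(IndV β ℬ A χ)) :
    hχ'.average A χ ω (hActV β ℬ A χ h f) = hActV β ℬ B χ' h (hχ'.average A χ ω f) := by
  ext x
  refine Finset.sum_congr rfl fun b _ => ?_
  change _ * f.1 (_ * _) = _ * f.1 (_ * _)
  rw [mul_assoc _ x h]

lemma exists_isUnit_average_average (h2 : (2 : F) ≠ 0) (halt : ∀ v : W, β v v = 0)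
    (hχ : IsPolarization θ A χ) (hχ' : IsPolarization θ B χ') (ω : Heis β)
    (hω : ∀ b : Heis β, b.w ∈ A → b.w ∈ B → χ (ω * b * ω⁻¹) = χ' b) :
    ∃ u : ℬ, IsUnit u ∧
      ∀ f, hχ.average B χ' ω⁻¹ (hχ'.average A χ ω f) = u • f := by
  classical
  refine ⟨_, hχ.card_isUnit.mul
    (isUnit_sum_indicator_subgroup hχ'.card_isUnit ((polar β A).subgroupOf (polar β B))),
    fun f => ?_⟩
  ext h
  change ∑ a : polar β A, (((χ a)⁻¹ : ℬˣ) : ℬ) *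
    ∑ b : polar β B, (((χ' b)⁻¹ : ℬˣ) : ℬ) * f.1 (ω * b * (ω⁻¹ * a * h)) = _ * f.1 h
  simp only [Finset.mul_sum]
  rw [Finset.sum_comm, Finset.sum_mul]
  refine Finset.sum_congr rfl fun b _ => ?_
  have hw : (ω * b.1 * ω⁻¹).w = b.1.w := by simp
  have h1 := hχ.sum_apply_mul_mul h2 halt f.2 (ω * b.1 * ω⁻¹) h
  calc _ = (((χ' b)⁻¹ : ℬˣ) : ℬ) *
        ∑ a : polar β A, (((χ a)⁻¹ : ℬˣ) : ℬ) * f.1 (ω * b * ω⁻¹ * a * h) := by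
        rw [Finset.mul_sum]
        refine Finset.sum_congr rfl fun a _ => ?_
        rw [mul_left_comm]
        simp only [mul_assoc]
    _ = _ := by
        rw [h1, hw]
        simp only [Subgroup.mem_subgroupOf, mem_polar]
        split_ifs with hb
        · rw [f.2 _ (hw ▸ hb), hω b hb b.2, mul_left_comm, Units.inv_mul_cancel_left, mul_one]
        · simp

/-- The averaging map attached to a suitable `ω` is bijective. -/
lemma average_bijective (h2 : (2 : F) ≠ 0) (halt : ∀ v : W, β v v = 0)
    (hχ : IsPolarization θ A χ) (hχ' : IsPolarization θ B χ') (ω : Heis β)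
    (hω : ∀ b : Heis β, b.w ∈ A → b.w ∈ B → χ (ω * b * ω⁻¹) = χ' b) :
    Function.Bijective (hχ'.average A χ ω) := by
  obtain ⟨u, hu, hl⟩ := exists_isUnit_average_average h2 halt hχ hχ' ω hω
  obtain ⟨v, hv, hr⟩ := exists_isUnit_average_average h2 halt hχ' hχ ω⁻¹ fun a ha hb => by
    rw [← hω (ω⁻¹ * a * ω⁻¹⁻¹) (by simpa using hb) (by simpa using ha)]
    congr 1
    group
  rw [inv_inv] at hr
  constructor
  · intro f g hfg
    have := congrArg (hχ.average B χ' ω⁻¹) hfg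
    rw [hl, hl] at this
    exact hu.smul_left_cancel.mp this
  · intro f
    obtain ⟨v, rfl⟩ := hv
    refine ⟨((v⁻¹ : ℬˣ) : ℬ) • hχ.average B χ' ω⁻¹ f, ?_⟩
    rw [map_smul, hr, smul_smul, Units.inv_mul, one_smul]

end IsPolarization

/-! ## Self-dual subgroups with characters valued in `𝒜` -/

/-- A self-dual subgroup `A` with a character `ψA` of `A_H` extending `ψ`. -/
structure IsSelfDualChar {β : W →ₗ[F] W →ₗ[F] F} {R : Type*} [CommRing R]
    (ψ : F → Rˣ) (A : AddSubgroup W) (ψA : Heis β → Rˣ) : Prop where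
  self_dual : ∀ v : W, (∀ a ∈ A, ψ (β v a) = 1) ↔ v ∈ A
  mul : ∀ a b : Heis β, a.w ∈ A → b.w ∈ A → ψA (a * b) = ψA a * ψA b
  central : ∀ t : F, ψA ⟨0, t⟩ = ψ t

lemma gHeis_mul {β : W →ₗ[F] W →ₗ[F] F} {g : W ≃ₗ[F] W}
    (hg : ∀ u v : W, β (g u) (g v) = β u v) (a b : Heis β) :
    gHeis β g (a * b) = gHeis β g a * gHeis β g b := by
  ext <;> simp [gHeis, hg]

lemma symm_preserves {β : W →ₗ[F] W →ₗ[F] F} {g : W ≃ₗ[F] W}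
    (hg : ∀ u v : W, β (g u) (g v) = β u v) (u v : W) :
    β (g.symm u) (g.symm v) = β u v := by
  rw [← hg, g.apply_symm_apply, g.apply_symm_apply]

/-- The translate `gA` of a subgroup by a linear automorphism. -/
def translateSubgroup (g : W ≃ₗ[F] W) (A : AddSubgroup W) : AddSubgroup W :=
  A.comap (g.symm : W →ₗ[F] W).toAddMonoidHom

lemma mem_translateSubgroup {g : W ≃ₗ[F] W} {A : AddSubgroup W} {v : W} :
    v ∈ translateSubgroup g A ↔ g.symm v ∈ A := Iff.rfl

namespace IsSelfDualChar

variable {β : W →ₗ[F] W →ₗ[F] F} {R : Type*} [CommRing R]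
  {ψ : F → Rˣ} {A B : AddSubgroup W} {ψA ψB : Heis β → Rˣ}

lemma translate (hA : IsSelfDualChar ψ A ψA) {g : W ≃ₗ[F] W}
    (hg : ∀ u v : W, β (g u) (g v) = β u v) :
    IsSelfDualChar ψ (translateSubgroup g A) (ψA ∘ gHeis β g.symm) where
  self_dual v := by
    rw [mem_translateSubgroup, ← hA.self_dual]
    constructor
    · intro h a ha
      have := h (g a) (by rwa [mem_translateSubgroup, g.symm_apply_apply])
      rwa [← symm_preserves hg, g.symm_apply_apply] at this
    · intro h a ha
      rw [← symm_preserves hg]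
      exact h _ ha
  mul a b ha hb := by
    simp only [Function.comp_apply, gHeis_mul (symm_preserves hg)]
    exact hA.mul _ _ ha hb
  central t := by
    rw [← hA.central]
    simp [gHeis]

variable [Finite F] [Finite W]

lemma isPolarization [IsDomain R] (hA : IsSelfDualChar ψ A ψA)
    (hψ : ∀ x y : F, ψ (x + y) = ψ x * ψ y)
    {ℬ : Type*} [CommRing ℬ] (φ : R →+* ℬ) (hcard : IsUnit (Nat.card (Heis β) : R)) :
    IsPolarization (fun t => Units.map φ.toMonoidHom (ψ t)) A
      (fun h : Heis β => Units.map φ.toMonoidHom (ψA h)) where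
  mul a b ha hb := by rw [hA.mul a b ha hb, map_mul]
  central t := by rw [hA.central]
  map_zero := by
    have := hψ 0 0
    rw [add_zero, left_eq_mul] at this
    rw [this, map_one]
  isotropic v hv a ha := by rw [(hA.self_dual v).mpr hv a ha, map_one]
  sum_eq_zero v hv := by
    rw [← hA.self_dual] at hv
    push Not at hv
    obtain ⟨a, ha, hne⟩ := hv
    have h := sum_eq_zero_of_translate (fun b : polar β A => (ψ (β v b.1.w) : R))
      (Equiv.mulLeft (⟨⟨a, 0⟩, ha⟩ : polar β A)) (c := ψ (β v a))
      (fun h => hne (Units.ext h)) (fun b => by simp [hψ])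
    have h1 := congrArg φ h
    rw [map_sum, map_zero] at h1
    exact h1
  card_isUnit := by
    have h1 : IsUnit (Fintype.card (polar β A) : R) := by
      refine isUnit_of_dvd_unit (Nat.cast_dvd_cast ?_) hcard
      rw [← Nat.card_eq_fintype_card]
      exact (polar β A).card_subgroup_dvd_card
    simpa using h1.map φ

/-- Two characters of self-dual subgroups with the same central character agree on the
intersection after conjugating one of them by an element of the Heisenberg group. -/
lemma exists_conj_eq [IsDomain R] [CharZero R] (h2 : (2 : F) ≠ 0) (halt : ∀ v : W, β v v = 0)
    (hnd : ∀ v : W, (∀ u : W, β v u = 0) → v = 0)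
    (hψ : ∀ x y : F, ψ (x + y) = ψ x * ψ y) (hψnt : ∃ x : F, ψ x ≠ 1)
    (hA : IsSelfDualChar ψ A ψA) (hB : IsSelfDualChar ψ B ψB) :
    ∃ ω : Heis β, ∀ b : Heis β, b.w ∈ A → b.w ∈ B → ψA (ω * b * ω⁻¹) = ψB b := by
  classical
  have : Fintype W := Fintype.ofFinite W
  have hconj (w : W) (b : Heis β) (hb : b.w ∈ A) :
      ψA (⟨w, 0⟩ * b * (⟨w, 0⟩ : Heis β)⁻¹) = ψ (β w b.w) * ψA b := by
    rw [conj_eq_central_mul h2 halt, hA.mul _ _ A.zero_mem hb, hA.central]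
  by_contra! hne
  let K := polar β (A ⊓ B)
  let q (w : W) (b : K) : Rˣ := ψ (β w b.1.w) * ψA b.1 * (ψB b.1)⁻¹
  have hq (w : W) (a b : K) : q w (a * b) = q w a * q w b := by
    simp only [q, Subgroup.coe_mul, mul_w, map_add, hψ, hA.mul _ _ a.2.1 b.2.1,
      hB.mul _ _ a.2.2 b.2.2, mul_inv]
    simp only [mul_assoc, mul_comm, mul_left_comm]
  have hrow (w : W) : ∑ b : K, (q w b : R) = 0 := by
    obtain ⟨b, hbA, hbB, hb⟩ := hne ⟨w, 0⟩
    rw [hconj w b hbA] at hb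
    refine sum_eq_zero_of_translate _ (Equiv.mulLeft (⟨b, hbA, hbB⟩ : K))
      (c := q w ⟨b, hbA, hbB⟩) (fun h => hb ?_) fun a => by
        rw [Equiv.coe_mulLeft, hq, Units.val_mul]
    exact mul_inv_eq_one.mp (Units.ext h)
  have hcol (b : K) : ∑ w : W, (q w b : R) = if b.1.w = 0 then (Fintype.card W : R) else 0 := by
    split_ifs with hb
    · have hbt : b.1 = ⟨0, b.1.t⟩ := Heis.ext hb rfl
      have hψ0 : ψ 0 = 1 := by simpa using hψ 0 0
      have hq1 (w : W) : q w b = 1 := by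
        simp only [q]
        rw [hb, hbt, hA.central, hB.central, map_zero, hψ0, one_mul, mul_inv_cancel]
      simp [hq1]
    · obtain ⟨u, hu⟩ : ∃ u, β b.1.w u ≠ 0 := by
        by_contra! h
        exact hb (hnd _ h)
      obtain ⟨x, hx⟩ := hψnt
      have hu' : β u b.1.w ≠ 0 := by
        rw [swap_of_alternating halt]
        exact neg_ne_zero.mpr hu
      refine sum_eq_zero_of_translate _ (Equiv.addLeft ((x / β u b.1.w) • u))
        (c := ψ x) (fun h => hx (Units.ext h)) fun w => ?_
      have : β ((x / β u b.1.w) • u + w) b.1.w = x + β w b.1.w := by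
        simp [div_mul_cancel₀ _ hu']
      simp only [q, Equiv.coe_addLeft, this, hψ, Units.val_mul, mul_assoc]
  have htotal : ∑ w : W, ∑ b : K, (q w b : R) = 0 := by simp [hrow]
  rw [Finset.sum_comm] at htotal
  simp only [hcol] at htotal
  rw [← Finset.sum_filter, Finset.sum_const, nsmul_eq_mul, mul_eq_zero, Nat.cast_eq_zero,
    Nat.cast_eq_zero, Finset.card_eq_zero] at htotal
  rcases htotal with h | h
  · exact Finset.notMem_empty (1 : K) (h ▸ by simp)
  · exact Fintype.card_ne_zero h

end IsSelfDualChar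

/-- Transport of structure `V_{A,χ} ≃ V_{gA, χ ∘ g⁻¹}`, `f ↦ f ∘ g⁻¹`. -/
def translateEquiv {β : W →ₗ[F] W →ₗ[F] F} {g : W ≃ₗ[F] W}
    (hg : ∀ u v : W, β (g u) (g v) = β u v) {ℬ : Type*} [CommRing ℬ] (A : AddSubgroup W)
    (χ : Heis β → ℬˣ) :
    ↥(IndV β ℬ A χ) ≃ₗ[ℬ] ↥(IndV β ℬ (translateSubgroup g A) (χ ∘ gHeis β g.symm)) where
  toFun f := ⟨f.1 ∘ gHeis β g.symm, fun a ha h => by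
    simp only [Function.comp_apply, gHeis_mul (symm_preserves hg)]
    exact f.2 (gHeis β g.symm a) ha _⟩
  invFun f := ⟨f.1 ∘ gHeis β g, fun a ha h => by
    have h1 := f.2 (gHeis β g a) (by simpa [mem_translateSubgroup, gHeis] using ha) (gHeis β g h)
    simp only [Function.comp_apply, gHeis_mul hg, h1]
    simp [gHeis]⟩
  left_inv f := by ext h; simp [gHeis]
  right_inv f := by ext h; simp [gHeis]
  map_add' _ _ := rfl
  map_smul' _ _ := rfl

lemma translateEquiv_hActV {β : W →ₗ[F] W →ₗ[F] F} {g : W ≃ₗ[F] W}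
    (hg : ∀ u v : W, β (g u) (g v) = β u v) {ℬ : Type*} [CommRing ℬ] (A : AddSubgroup W)
    (χ : Heis β → ℬˣ) (h : Heis β) (f : ↥(IndV β ℬ A χ)) :
    translateEquiv hg A χ (hActV β ℬ A χ h f) =
      hActV β ℬ _ _ (gHeis β g h) (translateEquiv hg A χ f) := by
  ext x
  change f.1 (gHeis β g.symm x * h) = f.1 (gHeis β g.symm (x * gHeis β g h))
  rw [gHeis_mul (symm_preserves hg)]
  simp [gHeis]

/-! ## The metaplectic group -/

section MetaCond

variable {β : W →ₗ[F] W →ₗ[F] F} {ℬ : Type*} [CommRing ℬ] {A : AddSubgroup W}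
  {χ : Heis β → ℬˣ}

lemma MetaCond.one : MetaCond β ℬ A χ 1 := ⟨fun _ _ => rfl, fun _ _ => rfl⟩

lemma MetaCond.mul {x y} (hx : MetaCond β ℬ A χ x) (hy : MetaCond β ℬ A χ y) :
    MetaCond β ℬ A χ (x * y) := by
  refine ⟨fun u v => (hx.1 _ _).trans (hy.1 u v), fun h f => ?_⟩
  change x.2 (y.2 _) = hActV β ℬ A χ (gHeis β x.1 (gHeis β y.1 h)) (x.2 (y.2 f))
  rw [hy.2, hx.2]

lemma MetaCond.inv {x} (hx : MetaCond β ℬ A χ x) : MetaCond β ℬ A χ x⁻¹ := by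
  refine ⟨symm_preserves hx.1, fun h f => ?_⟩
  change x.2.symm _ = hActV β ℬ A χ (gHeis β x.1.symm h) (x.2.symm f)
  rw [LinearEquiv.symm_apply_eq, hx.2, LinearEquiv.apply_symm_apply]
  simp [gHeis]

lemma MetaCond.commute {x} (hx : MetaCond β ℬ A χ x) (h1 : x.1 = 1) (h : Heis β)
    (f : ↥(IndV β ℬ A χ)) : x.2 (hActV β ℬ A χ h f) = hActV β ℬ A χ h (x.2 f) := by
  rw [hx.2, h1]
  rfl

/-- An element of the metaplectic group lying over `1` is a unit scalar. -/
lemma MetaCond.exists_eq_smul [Finite F] [Finite W] (h2 : (2 : F) ≠ 0)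
    (halt : ∀ v : W, β v v = 0) {θ : F → ℬˣ} (hχ : IsPolarization θ A χ)
    {x} (hx : MetaCond β ℬ A χ x) (h1 : x.1 = 1) :
    ∃ lam : ℬˣ, ∀ f : ↥(IndV β ℬ A χ), x.2 f = (lam : ℬ) • f := by
  have hM := hχ.eq_smul_of_commute h2 halt x.2.toLinearMap (hx.commute h1)
  have h3 := hM (x.2.symm hχ.delta)
  rw [LinearEquiv.coe_coe, LinearEquiv.apply_symm_apply] at h3
  have h5 := congrArg (fun f => f.1 1) h3
  simp only [SetLike.val_smul, Pi.smul_apply, smul_eq_mul, hχ.delta_one] at h5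
  exact ⟨Units.mkOfMulEqOne _ _ h5.symm, hM⟩

end MetaCond

/-- The set `S̃p_A^ℬ(W)` of pairs `(g, M)` with `M ρ(h) = ρ(g·h) M` is a
subgroup of `Sp(W) × GL_ℬ(V_A^ℬ)`; the first projection is a surjective homomorphism onto
`Sp(W)` whose kernel is the central subgroup `{(id, λ·id) : λ ∈ ℬˣ} ≅ ℬˣ`, so that
`S̃p_A^ℬ(W)` is a central extension of `Sp(W)` by `ℬˣ` (the metaplectic group over `ℬ`). -/
theorem statement_6
    (p : ℕ+) [Fact (Nat.Prime (p : ℕ))] (hp2 : (p : ℕ) ≠ 2)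
    {F : Type*} [Field F] [Fintype F] [CharP F (p : ℕ)]
    {W : Type*} [AddCommGroup W] [Module F W] [FiniteDimensional F W]
    (β : W →ₗ[F] W →ₗ[F] F)
    (halt : ∀ v : W, β v v = 0)
    (hnd : ∀ v : W, (∀ u : W, β v u = 0) → v = 0)
    (ℬ : Type*) [CommRing ℬ] [Algebra (AA p) ℬ]
    (ψ : F → (AA p)ˣ) (hψ : ∀ x y : F, ψ (x + y) = ψ x * ψ y)
    (hψnt : ∃ x : F, ψ x ≠ 1)
    (A : AddSubgroup W)
    (hA : ∀ v : W, (∀ a ∈ A, ψ (β v a) = 1) ↔ v ∈ A)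
    (ψA : Heis β → (AA p)ˣ)
    (hψA : ∀ a b : Heis β, a.w ∈ A → b.w ∈ A → ψA (a * b) = ψA a * ψA b)
    (hψAext : ∀ t : F, ψA ⟨0, t⟩ = ψ t) :
    -- `S̃p_A^ℬ(W)` is a subgroup of the product group
    ((1 : (W ≃ₗ[F] W) × (↥(IndV β ℬ A (chB p ℬ ψA)) ≃ₗ[ℬ] ↥(IndV β ℬ A (chB p ℬ ψA)))) ∈
        {x | MetaCond β ℬ A (chB p ℬ ψA) x}) ∧
    (∀ x y, MetaCond β ℬ A (chB p ℬ ψA) x → MetaCond β ℬ A (chB p ℬ ψA) y →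
      MetaCond β ℬ A (chB p ℬ ψA) (x * y)) ∧
    (∀ x, MetaCond β ℬ A (chB p ℬ ψA) x → MetaCond β ℬ A (chB p ℬ ψA) x⁻¹) ∧
    -- the first projection surjects onto `Sp(W)`
    (∀ g : W ≃ₗ[F] W, (∀ u v : W, β (g u) (g v) = β u v) →
      ∃ M, MetaCond β ℬ A (chB p ℬ ψA) (g, M)) ∧
    -- its kernel is exactly `{(id, λ·id) : λ ∈ ℬˣ}`
    ({x | MetaCond β ℬ A (chB p ℬ ψA) x ∧ x.1 = 1} =
      {x | x.1 = 1 ∧ ∃ lam : ℬˣ,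
        ∀ f : ↥(IndV β ℬ A (chB p ℬ ψA)), x.2 f = (lam : ℬ) • f}) ∧
    -- the kernel is central
    (∀ x z, MetaCond β ℬ A (chB p ℬ ψA) x → MetaCond β ℬ A (chB p ℬ ψA) z →
      z.1 = 1 → z * x = x * z) ∧
    -- and it is isomorphic to `ℬˣ` (the parametrisation `λ ↦ λ·id` is injective)
    (∀ lam mu : ℬˣ,
      (∀ f : ↥(IndV β ℬ A (chB p ℬ ψA)), (lam : ℬ) • f = (mu : ℬ) • f) → lam = mu) := by
  have hF2 : (2 : F) ≠ 0 := Ring.two_ne_zero (by rwa [ringChar.eq F (p : ℕ)])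
  have : Finite W := Module.finite_of_finite F
  have := AA_isDomain p
  have := AA_charZero p
  have hcard : IsUnit (Nat.card (Heis β) : AA p) := by
    obtain ⟨n, -, hn⟩ := FiniteField.card F (p : ℕ)
    rw [Nat.card_congr (equivProd β), Nat.card_prod, Module.natCard_eq_pow_finrank (K := F),
      Nat.card_eq_fintype_card, hn, ← pow_mul, ← pow_add, Nat.cast_pow]
    exact (AA_isUnit_natCast p).pow _
  have hsd : IsSelfDualChar ψ A ψA := ⟨hA, hψA, hψAext⟩
  have hpol : IsPolarization (psB p ℬ ψ) A (chB p ℬ ψA) :=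
    hsd.isPolarization hψ (algebraMap (AA p) ℬ) hcard
  refine ⟨MetaCond.one, fun x y => MetaCond.mul, fun x => MetaCond.inv, fun g hg => ?_,
    Set.ext fun x => ⟨fun hx => ⟨hx.2, hx.1.exists_eq_smul hF2 halt hpol hx.2⟩, ?_⟩,
    fun x z hx hz hz1 => ?_, fun lam mu h => ?_⟩
  · have hsd' := hsd.translate hg
    have hpol' : IsPolarization (psB p ℬ ψ) (translateSubgroup g A)
        (chB p ℬ ψA ∘ gHeis β g.symm) :=
      hsd'.isPolarization hψ (algebraMap (AA p) ℬ) hcard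
    obtain ⟨ω, hω⟩ := hsd'.exists_conj_eq hF2 halt hnd hψ hψnt hsd
    have hbij := hpol'.average_bijective hF2 halt hpol ω fun b hb hb' =>
      congrArg (Units.map (algebraMap (AA p) ℬ).toMonoidHom) (hω b hb hb')
    refine ⟨(translateEquiv hg A (chB p ℬ ψA)).trans (LinearEquiv.ofBijective _ hbij), hg,
      fun h f => ?_⟩
    simp only [LinearEquiv.trans_apply, LinearEquiv.ofBijective_apply]
    rw [translateEquiv_hActV, IsPolarization.average_hActV]
  · rintro ⟨hx1, lam, hlam⟩
    refine ⟨⟨fun u v => by rw [hx1]; rfl, fun h f => ?_⟩, hx1⟩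
    rw [hlam, hlam, map_smul, hx1]
    rfl
  · obtain ⟨lam, hlam⟩ := hz.exists_eq_smul hF2 halt hpol hz1
    refine Prod.ext ?_ (LinearEquiv.ext fun f => ?_)
    · rw [Prod.fst_mul, Prod.fst_mul, hz1, one_mul, mul_one]
    · change z.2 (x.2 f) = x.2 (z.2 f)
      rw [hlam, hlam, map_smul]
  · have h1 := congrArg (fun f => f.1 1) (h hpol.delta)
    simp only [SetLike.val_smul, Pi.smul_apply, smul_eq_mul, hpol.delta_one, mul_one] at h1
    exact Units.ext h1
end
end
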